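/- arXiv:2604.03530 — 2 statements merged into one kernel-verified Lean document; each statement's English description precedes it below -/
import Mathlib

section
/- Let G be a finite connected simple graph and let r ≠ 1 be a real number with Rel(G;r) = 0. Let H be a finite connected simple graph with two distinguished nonadjacent terminal vertices u and v, and let G[H] be the edge-substitution graph obtained from G by replacing each edge ab of G by a fresh copy of H, identifying u with a and v with b. Then every real number q satisfying S(H;q) = (r/(1-r)) · Rel(H;q) satisfies Rel(H;q) = 0 or Rel(G[H];q) = 0. -/
open SimpleGraph Finset

noncomputable section

/-- The finset of edges of a simple graph on a finite vertex type. -/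
def edgeFin {V : Type} [Finite V] (G : SimpleGraph V) : Finset (Sym2 V) :=
  (Set.toFinite G.edgeSet).toFinset

open Classical in
/-- All-terminal reliability polynomial: `relPoly G q` is the probability that the graph stays
connected when every edge fails independently with probability `q`. -/
def relPoly {V : Type} [Finite V] (G : SimpleGraph V) (q : ℝ) : ℝ :=
  ∑ A ∈ (edgeFin G).powerset,
    if (SimpleGraph.fromEdgeSet (A : Set (Sym2 V))).Connected then
      (1 - q) ^ A.card * q ^ ((edgeFin G).card - A.card) else 0

open Classical in
/-- Split reliability polynomial with terminals `u`, `v`: the sum is over edge subsets whose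
spanning subgraph has exactly two components, one containing `u` and the other containing `v`. -/
def splitRel {V : Type} [Finite V] (H : SimpleGraph V) (u v : V) (q : ℝ) : ℝ :=
  ∑ A ∈ (edgeFin H).powerset,
    if (¬ (SimpleGraph.fromEdgeSet (A : Set (Sym2 V))).Reachable u v ∧
        ∀ w, (SimpleGraph.fromEdgeSet (A : Set (Sym2 V))).Reachable u w ∨
             (SimpleGraph.fromEdgeSet (A : Set (Sym2 V))).Reachable v w) then
      (1 - q) ^ A.card * q ^ ((edgeFin H).card - A.card) else 0

/-- The virtual edge interaction `ŷ_H = Rel(H)/S(H) + 1`. -/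
def yhat {V : Type} [Finite V] (H : SimpleGraph V) (u v : V) (q : ℝ) : ℝ :=
  relPoly H q / splitRel H u v q + 1

/-- Vertex type of the edge-substitution graph `G[H]`: the original vertices of `G` together
with, for each edge of `G`, a fresh copy of the non-terminal vertices of `H`. -/
abbrev SubVert {V W : Type} (G : SimpleGraph V) (u v : W) : Type :=
  V ⊕ (G.edgeSet × {w : W // w ≠ u ∧ w ≠ v})

open Classical in
/-- Embedding of the copy of `H` corresponding to the edge `e` of `G` into the vertex set of
`G[H]`: the terminal `u` goes to one endpoint of `e`, the terminal `v` to the other endpoint,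
and the remaining vertices go to the fresh copy indexed by `e`. -/
def embv {V W : Type} (G : SimpleGraph V) (u v : W) (e : G.edgeSet) (w : W) :
    SubVert G u v :=
  if h1 : w = u then Sum.inl (Quot.out e.1).1
  else if h2 : w = v then Sum.inl (Quot.out e.1).2
  else Sum.inr (e, ⟨w, h1, h2⟩)

/-- The edge-substitution graph `G[H]`: every edge `ab` of `G` is replaced by a fresh copy of
`H`, identifying the terminal `u` with `a` and the terminal `v` with `b`. -/
def subGraph {V W : Type} (G : SimpleGraph V) (H : SimpleGraph W) (u v : W) :
    SimpleGraph (SubVert G u v) :=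
  SimpleGraph.fromRel (fun x y =>
    ∃ (e : G.edgeSet) (a b : W), H.Adj a b ∧ x = embv G u v e a ∧ y = embv G u v e b)

open Classical in
/-- `Fpoly G z = ∑_i F_i z^i`, where `F_i` is the number of `i`-element edge subsets of `G`
whose deletion leaves a connected graph. -/
def Fpoly {V : Type} [Finite V] (G : SimpleGraph V) (z : ℝ) : ℝ :=
  ∑ B ∈ (edgeFin G).powerset,
    if (G.deleteEdges (B : Set (Sym2 V))).Connected then z ^ B.card else 0

namespace SimpleGraph

theorem Reachable.map_of_adj {V W : Type*} {G : SimpleGraph V} {K : SimpleGraph W} (φ : V → W)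
    (h : ∀ x y, G.Adj x y → K.Reachable (φ x) (φ y)) {x y : V} (hxy : G.Reachable x y) :
    K.Reachable (φ x) (φ y) := by
  obtain ⟨p⟩ := hxy
  induction p with
  | nil => exact Reachable.refl _
  | cons hadj _ ih => exact (h _ _ hadj).trans ih

theorem Reachable.mem_of_adj {V : Type*} {G : SimpleGraph V} (C : Set V)
    (h : ∀ x y, G.Adj x y → x ∈ C → y ∈ C) {x y : V} (hxy : G.Reachable x y) (hx : x ∈ C) :
    y ∈ C := by
  obtain ⟨p⟩ := hxy
  induction p with
  | nil => exact hx
  | cons hadj _ ih => exact ih (h _ _ hadj hx)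

theorem connected_iff_reachable_terminals {W : Type*} (K : SimpleGraph W) (u v : W) :
    K.Connected ↔ K.Reachable u v ∧ ∀ w, K.Reachable u w ∨ K.Reachable v w := by
  constructor
  · intro h
    exact ⟨h.preconnected u v, fun w => Or.inl (h.preconnected u w)⟩
  · rintro ⟨huv, h⟩
    have hu : ∀ w, K.Reachable u w := fun w => (h w).elim id huv.trans
    have : Nonempty W := ⟨u⟩
    exact ⟨fun x y => (hu x).symm.trans (hu y)⟩

end SimpleGraph

section DisjointImages

open Classical in
/-- The union of the images of the finsets `f i` under the maps `φ i`. -/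
def unionImage {ι α β : Type*} [Fintype ι] (φ : ι → α → β) (f : ι → Finset α) : Finset β :=
  Finset.univ.biUnion fun i => (f i).image (φ i)

variable {ι α β : Type*} [Fintype ι] {φ : ι → α → β}

theorem mem_unionImage {f : ι → Finset α} {x : β} :
    x ∈ unionImage φ f ↔ ∃ i, ∃ a ∈ f i, φ i a = x := by
  simp [unionImage]

theorem card_unionImage {E : Finset α}
    (hφ : ∀ i j, ∀ a ∈ E, ∀ b ∈ E, φ i a = φ j b → i = j ∧ a = b)
    {f : ι → Finset α} (hf : ∀ i, f i ⊆ E) :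
    (unionImage φ f).card = ∑ i, (f i).card := by
  classical
  rw [unionImage, Finset.card_biUnion]
  · refine Finset.sum_congr rfl fun i _ => Finset.card_image_of_injOn ?_
    intro a ha b hb hab
    exact (hφ i i a (hf i ha) b (hf i hb) hab).2
  · intro i _ j _ hij
    refine Finset.disjoint_left.2 ?_
    intro x hx hx'
    obtain ⟨a, ha, rfl⟩ := Finset.mem_image.1 hx
    obtain ⟨b, hb, hab⟩ := Finset.mem_image.1 hx'
    exact hij (hφ j i b (hf j hb) a (hf i ha) hab).1.symm

theorem sum_powerset_unionImage [DecidableEq ι] {M : Type*} [AddCommMonoid M] {E : Finset α}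
    (hφ : ∀ i j, ∀ a ∈ E, ∀ b ∈ E, φ i a = φ j b → i = j ∧ a = b) (F : Finset β → M) :
    ∑ A ∈ (unionImage φ fun _ => E).powerset, F A =
      ∑ f ∈ Fintype.piFinset (fun _ : ι => E.powerset), F (unionImage φ f) := by
  classical
  symm
  refine Finset.sum_bij' (fun f _ => unionImage φ f)
    (fun A _ i => E.filter fun a => φ i a ∈ A) ?_ ?_ ?_ ?_ ?_
  · intro f hf
    simp only [Fintype.mem_piFinset, Finset.mem_powerset] at hf ⊢
    intro x hx
    obtain ⟨i, a, ha, rfl⟩ := mem_unionImage.1 hx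
    exact mem_unionImage.2 ⟨i, a, hf i ha, rfl⟩
  · intro A _
    simp
  · intro f hf
    simp only [Fintype.mem_piFinset, Finset.mem_powerset] at hf
    funext i
    ext a
    simp only [Finset.mem_filter, mem_unionImage]
    constructor
    · rintro ⟨ha, j, b, hb, hba⟩
      obtain ⟨rfl, rfl⟩ := hφ j i b (hf j hb) a ha hba
      exact hb
    · exact fun ha => ⟨hf i ha, i, a, ha, rfl⟩
  · intro A hA
    rw [Finset.mem_powerset] at hA
    ext x
    simp only [mem_unionImage, Finset.mem_filter]
    constructor
    · rintro ⟨i, a, ⟨_, h⟩, rfl⟩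
      exact h
    · intro hx
      obtain ⟨i, a, ha, rfl⟩ := mem_unionImage.1 (hA hx)
      exact ⟨i, a, ⟨ha, hx⟩, rfl⟩
  · intro f _
    rfl

end DisjointImages

section Substitution

variable {V W : Type} {G : SimpleGraph V} {u v : W}

theorem mem_edgeFin {V : Type} [Finite V] {G : SimpleGraph V} {e : Sym2 V} :
    e ∈ edgeFin G ↔ e ∈ G.edgeSet := by
  simp [edgeFin]

theorem mk_out_edge (e : G.edgeSet) : s((Quot.out e.1).1, (Quot.out e.1).2) = e.1 :=
  Quot.out_eq e.1

theorem out_fst_ne_out_snd (e : G.edgeSet) : (Quot.out e.1).1 ≠ (Quot.out e.1).2 := by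
  have h : G.Adj (Quot.out e.1).1 (Quot.out e.1).2 := by
    rw [← SimpleGraph.mem_edgeSet, mk_out_edge]
    exact e.2
  exact h.ne

theorem embv_left (e : G.edgeSet) : embv G u v e u = Sum.inl (Quot.out e.1).1 := by
  simp [embv]

theorem embv_right (huv : u ≠ v) (e : G.edgeSet) :
    embv G u v e v = Sum.inl (Quot.out e.1).2 := by
  simp [embv, huv.symm]

theorem embv_interior (e : G.edgeSet) {w : W} (h : w ≠ u ∧ w ≠ v) :
    embv G u v e w = Sum.inr (e, ⟨w, h⟩) := by
  simp [embv, h.1, h.2]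

theorem embv_eq_inr {e e' : G.edgeSet} {w : W} {w' : {w : W // w ≠ u ∧ w ≠ v}}
    (h : embv G u v e w = Sum.inr (e', w')) : e = e' ∧ w = w' := by
  unfold embv at h
  split_ifs at h
  simp only [Sum.inr.injEq, Prod.mk.injEq] at h
  exact ⟨h.1, congrArg Subtype.val h.2⟩

theorem embv_injective (e : G.edgeSet) : Function.Injective (embv G u v e) := by
  intro a b h
  have hne := out_fst_ne_out_snd e
  unfold embv at h
  split_ifs at h <;> simp_all

theorem map_embv_injective {H : SimpleGraph W} (hadj : ¬ H.Adj u v) {e e' : G.edgeSet}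
    {s s' : Sym2 W} (hs : s ∈ H.edgeSet)
    (h : s.map (embv G u v e) = s'.map (embv G u v e')) : e = e' ∧ s = s' := by
  have key : e = e' := by
    have hinterior : ∃ w ∈ s, w ≠ u ∧ w ≠ v := by
      induction s with
      | _ a b =>
        rw [SimpleGraph.mem_edgeSet] at hs
        by_contra! hcon
        have ha := hcon a (Sym2.mem_mk_left a b)
        have hb := hcon b (Sym2.mem_mk_right a b)
        have hab := hs.ne
        by_cases hau : a = u
        · by_cases hbu : b = u
          · exact hab (hau.trans hbu.symm)
          · exact hadj (by rwa [hau, hb hbu] at hs)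
        · by_cases hbu : b = u
          · exact hadj (by rw [ha hau, hbu] at hs; exact hs.symm)
          · exact hab ((ha hau).trans (hb hbu).symm)
    obtain ⟨w, hw, hint⟩ := hinterior
    have hmem : embv G u v e w ∈ s'.map (embv G u v e') :=
      h ▸ Sym2.mem_map.2 ⟨w, hw, rfl⟩
    obtain ⟨w', _, hw'⟩ := Sym2.mem_map.1 hmem
    rw [embv_interior e hint] at hw'
    exact (embv_eq_inr hw').1.symm
  subst key
  exact ⟨rfl, Sym2.map.injective (embv_injective e) h⟩

theorem edgeFin_subGraph [Finite V] [Finite W] [Fintype G.edgeSet] (H : SimpleGraph W) :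
    edgeFin (subGraph G H u v) =
      unionImage (fun e => Sym2.map (embv G u v e)) fun _ => edgeFin H := by
  ext s
  induction s with
  | _ x y =>
    simp only [mem_edgeFin, mem_unionImage, SimpleGraph.mem_edgeSet, subGraph,
      SimpleGraph.fromRel_adj]
    constructor
    · rintro ⟨_, ⟨e, a, b, hab, rfl, rfl⟩ | ⟨e, a, b, hab, rfl, rfl⟩⟩
      · exact ⟨e, s(a, b), hab, rfl⟩
      · exact ⟨e, s(b, a), hab.symm, rfl⟩
    · rintro ⟨e, s, hs, hxy⟩
      induction s with
      | _ a b =>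
        rw [SimpleGraph.mem_edgeSet] at hs
        rw [Sym2.map_mk, Sym2.eq_iff] at hxy
        rcases hxy with ⟨rfl, rfl⟩ | ⟨rfl, rfl⟩
        · exact ⟨fun h => hs.ne (embv_injective e h), Or.inl ⟨e, a, b, hs, rfl, rfl⟩⟩
        · exact ⟨fun h => hs.ne (embv_injective e h).symm, Or.inr ⟨e, a, b, hs, rfl, rfl⟩⟩

/-- A choice of edges in each copy of `H` spans a connected subgraph of `G[H]` iff in each copy
every vertex is joined to a terminal, and the edges of `G` whose copy joins its two terminals span
a connected subgraph of `G`. -/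
theorem connected_unionImage_iff [Fintype G.edgeSet] (huv : u ≠ v)
    (f : G.edgeSet → Finset (Sym2 W)) :
    (fromEdgeSet (unionImage (fun e => Sym2.map (embv G u v e)) f : Set (Sym2 (SubVert G u v)))).Connected ↔
      (∀ e w, (fromEdgeSet (f e : Set (Sym2 W))).Reachable u w ∨
          (fromEdgeSet (f e : Set (Sym2 W))).Reachable v w) ∧
        (fromEdgeSet {s : Sym2 V | ∃ e : G.edgeSet, e.1 = s ∧
          (fromEdgeSet (f e : Set (Sym2 W))).Reachable u v}).Connected := by
  classical
  set K := fromEdgeSet (unionImage (fun e => Sym2.map (embv G u v e)) f : Set (Sym2 (SubVert G u v))) with hK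
  set L := fromEdgeSet {s : Sym2 V | ∃ e : G.edgeSet, e.1 = s ∧
          (fromEdgeSet (f e : Set (Sym2 W))).Reachable u v} with hL
  have hKadj : ∀ x y, K.Adj x y → ∃ e a b, (fromEdgeSet (f e : Set (Sym2 W))).Adj a b ∧
      x = embv G u v e a ∧ y = embv G u v e b := by
    intro x y h
    rw [hK, fromEdgeSet_adj, Finset.mem_coe, mem_unionImage] at h
    obtain ⟨⟨e, s, hs, hxy⟩, hne⟩ := h
    induction s with
    | _ a b =>
      rw [Sym2.map_mk, Sym2.eq_iff] at hxy
      rcases hxy with ⟨rfl, rfl⟩ | ⟨rfl, rfl⟩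
      · exact ⟨e, a, b, (fromEdgeSet_adj _).2 ⟨hs, fun h => hne (by rw [h])⟩, rfl, rfl⟩
      · exact ⟨e, b, a, ((fromEdgeSet_adj _).2 ⟨hs, fun h => hne (by rw [h])⟩).symm, rfl, rfl⟩
  have hKreach : ∀ e a b, (fromEdgeSet (f e : Set (Sym2 W))).Reachable a b →
      K.Reachable (embv G u v e a) (embv G u v e b) := by
    intro e a b h
    refine h.map_of_adj (embv G u v e) fun a b hab => ?_
    rw [fromEdgeSet_adj] at hab
    refine SimpleGraph.Adj.reachable ?_
    rw [hK, fromEdgeSet_adj, Finset.mem_coe, mem_unionImage]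
    exact ⟨⟨e, s(a, b), hab.1, rfl⟩, fun h => hab.2 (embv_injective e h)⟩
  constructor
  · intro hconn
    have hVne : Nonempty V := by
      obtain ⟨a | ⟨e, _⟩⟩ := hconn.nonempty
      · exact ⟨a⟩
      · exact ⟨(Quot.out e.1).1⟩
    refine ⟨fun e w => ?_, ?_⟩
    · by_contra hw
      have hint : ∀ {w}, ¬ ((fromEdgeSet (f e : Set (Sym2 W))).Reachable u w ∨
          (fromEdgeSet (f e : Set (Sym2 W))).Reachable v w) → w ≠ u ∧ w ≠ v := by
        intro w hw
        constructor
        · rintro rfl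
          exact hw (Or.inl (Reachable.refl _))
        · rintro rfl
          exact hw (Or.inr (Reachable.refl _))
      obtain ⟨a⟩ := hVne
      have hmem := (hconn.preconnected (embv G u v e w) (Sum.inl a)).mem_of_adj
        {x | ∃ w', ¬ ((fromEdgeSet (f e : Set (Sym2 W))).Reachable u w' ∨
          (fromEdgeSet (f e : Set (Sym2 W))).Reachable v w') ∧ x = embv G u v e w'} ?_
        ⟨w, hw, rfl⟩
      · obtain ⟨w', hw', h⟩ := hmem
        rw [embv_interior e (hint hw')] at h
        exact Sum.inl_ne_inr h
      · rintro x y hxy ⟨w', hw', rfl⟩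
        obtain ⟨e', a, b, hab, hxa, rfl⟩ := hKadj _ _ hxy
        rw [embv_interior e (hint hw')] at hxa
        obtain ⟨rfl, rfl⟩ := embv_eq_inr hxa.symm
        refine ⟨b, fun hb => hw' ?_, rfl⟩
        exact hb.imp (fun h => h.trans hab.symm.reachable) (fun h => h.trans hab.symm.reachable)
    · let T : G.edgeSet → W → V := fun e w =>
        if (fromEdgeSet (f e : Set (Sym2 W))).Reachable u w then (Quot.out e.1).1
        else (Quot.out e.1).2
      let π : SubVert G u v → V := Sum.elim id fun p => T p.1 p.2.1
      have hT : ∀ e w, L.Reachable (π (embv G u v e w)) (T e w) := by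
        intro e w
        by_cases hwu : w = u
        · subst hwu
          rw [embv_left]
          simp [π, T]
        by_cases hwv : w = v
        · subst hwv
          rw [embv_right huv]
          by_cases h : (fromEdgeSet (f e : Set (Sym2 W))).Reachable u w
          · simp only [π, T, Sum.elim_inl, id, if_pos h]
            refine SimpleGraph.Adj.reachable (SimpleGraph.Adj.symm ?_)
            rw [hL, fromEdgeSet_adj]
            exact ⟨⟨e, (mk_out_edge e).symm, h⟩, out_fst_ne_out_snd e⟩
          · simp [π, T, h]
        · rw [embv_interior e ⟨hwu, hwv⟩]
          exact Reachable.refl _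
      have hπ : ∀ x y, K.Adj x y → L.Reachable (π x) (π y) := by
        intro x y hxy
        obtain ⟨e, a, b, hab, rfl, rfl⟩ := hKadj _ _ hxy
        have hTab : T e a = T e b := by
          have : (fromEdgeSet (f e : Set (Sym2 W))).Reachable u a ↔
              (fromEdgeSet (f e : Set (Sym2 W))).Reachable u b :=
            ⟨fun h => h.trans hab.reachable, fun h => h.trans hab.symm.reachable⟩
          simp only [T, this]
        exact (hT e a).trans (hTab ▸ (hT e b).symm)
      exact ⟨fun a b => (hconn.preconnected (Sum.inl a) (Sum.inl b)).map_of_adj π hπ⟩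
  · rintro ⟨hP, hconn⟩
    have hLK : ∀ a b : V, K.Reachable (Sum.inl a) (Sum.inl b) := by
      intro a b
      refine (hconn.preconnected a b).map_of_adj (Sum.inl : V → SubVert G u v) fun a b hab => ?_
      rw [hL, fromEdgeSet_adj] at hab
      obtain ⟨⟨e, he, hr⟩, _⟩ := hab
      have h := hKreach e u v hr
      rw [embv_left, embv_right huv] at h
      rw [← mk_out_edge e, Sym2.eq_iff] at he
      rcases he with ⟨h1, h2⟩ | ⟨h1, h2⟩
      · rwa [h1, h2] at h
      · rw [h1, h2] at h
        exact h.symm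
    obtain ⟨a₀⟩ := hconn.nonempty
    have hbase : ∀ x, K.Reachable (Sum.inl a₀) x := by
      rintro (a | ⟨e, w, hw⟩)
      · exact hLK a₀ a
      · rw [← embv_interior e hw]
        rcases hP e w with h | h
        · refine (hLK a₀ (Quot.out e.1).1).trans ?_
          rw [← embv_left (u := u) (v := v)]
          exact hKreach e _ _ h
        · refine (hLK a₀ (Quot.out e.1).2).trans ?_
          rw [← embv_right (u := u) huv]
          exact hKreach e _ _ h
    have : Nonempty (SubVert G u v) := ⟨Sum.inl a₀⟩
    exact ⟨fun x y => (hbase x).symm.trans (hbase y)⟩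

open Classical in
/-- The reliability of `G[H]` in terms of the reliability and split reliability of `H`. -/
theorem relPoly_subGraph [Finite V] [Finite W] (G : SimpleGraph V) (H : SimpleGraph W)
    (huv : u ≠ v) (hadj : ¬ H.Adj u v) (q : ℝ) :
    relPoly (subGraph G H u v) q =
      ∑ B ∈ (edgeFin G).powerset,
        if (fromEdgeSet (B : Set (Sym2 V))).Connected then
          relPoly H q ^ B.card * splitRel H u v q ^ ((edgeFin G).card - B.card) else 0 := by
  have : Fintype G.edgeSet := Fintype.ofFinite _
  have hφ : ∀ e e' : G.edgeSet, ∀ s ∈ edgeFin H, ∀ s' ∈ edgeFin H,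
      s.map (embv G u v e) = s'.map (embv G u v e') → e = e' ∧ s = s' :=
    fun e e' s hs s' _ h => map_embv_injective hadj (mem_edgeFin.1 hs) h
  set m := (edgeFin H).card with hm
  let w : Finset (Sym2 W) → ℝ := fun A => (1 - q) ^ A.card * q ^ (m - A.card)
  let P : Finset (Sym2 W) → Prop := fun A => ∀ x,
    (fromEdgeSet (A : Set (Sym2 W))).Reachable u x ∨ (fromEdgeSet (A : Set (Sym2 W))).Reachable v x
  let J : Finset (Sym2 W) → Prop := fun A => (fromEdgeSet (A : Set (Sym2 W))).Reachable u v
  let joined : (G.edgeSet → Finset (Sym2 W)) → Finset (Sym2 V) := fun f =>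
    (edgeFin G).filter fun s => ∃ e : G.edgeSet, e.1 = s ∧ J (f e)
  have hjoined : ∀ f (e : G.edgeSet), e.1 ∈ joined f ↔ J (f e) := by
    intro f e
    simp only [joined, Finset.mem_filter, mem_edgeFin]
    constructor
    · rintro ⟨_, e', he', h⟩
      rwa [← Subtype.ext he']
    · exact fun h => ⟨e.2, e, rfl, h⟩
  have hlhs : relPoly (subGraph G H u v) q =
      ∑ f ∈ Fintype.piFinset (fun _ : G.edgeSet => (edgeFin H).powerset),
        if (∀ e, P (f e)) ∧ (fromEdgeSet (joined f : Set (Sym2 V))).Connected then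
          ∏ e, w (f e) else 0 := by
    rw [relPoly, edgeFin_subGraph, sum_powerset_unionImage hφ]
    refine Finset.sum_congr rfl fun f hf => ?_
    simp only [Fintype.mem_piFinset, Finset.mem_powerset] at hf
    have hset : {s : Sym2 V | ∃ e : G.edgeSet, e.1 = s ∧
        (fromEdgeSet (f e : Set (Sym2 W))).Reachable u v} = (joined f : Set (Sym2 V)) := by
      ext s
      simp only [joined, J, Set.mem_ofPred_eq, Finset.coe_filter, mem_edgeFin]
      constructor
      · rintro ⟨e, rfl, h⟩
        exact ⟨e.2, e, rfl, h⟩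
      · exact fun h => h.2
    refine if_congr ?_ ?_ rfl
    · rw [connected_unionImage_iff huv, hset]
    · rw [card_unionImage hφ hf, card_unionImage hφ fun _ => subset_rfl,
        ← Finset.sum_tsub_distrib _ fun e _ => Finset.card_le_card (hf e),
        ← Finset.prod_pow_eq_pow_sum, ← Finset.prod_pow_eq_pow_sum, ← Finset.prod_mul_distrib]
  have hrel : relPoly H q =
      ∑ A ∈ (edgeFin H).powerset, if J A ∧ P A then w A else 0 :=
    Finset.sum_congr rfl fun A _ =>
      if_congr (connected_iff_reachable_terminals _ u v) rfl rfl
  have hsplit : splitRel H u v q =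
      ∑ A ∈ (edgeFin H).powerset, if ¬ J A ∧ P A then w A else 0 := rfl
  have hterm : ∀ B ∈ (edgeFin G).powerset,
      relPoly H q ^ B.card * splitRel H u v q ^ ((edgeFin G).card - B.card) =
      ∑ f ∈ Fintype.piFinset (fun _ : G.edgeSet => (edgeFin H).powerset),
        if B = joined f ∧ ∀ e, P (f e) then ∏ e, w (f e) else 0 := by
    intro B hB
    rw [Finset.mem_powerset] at hB
    have hprod : relPoly H q ^ B.card * splitRel H u v q ^ ((edgeFin G).card - B.card) =
        ∏ e : G.edgeSet, if e.1 ∈ B then relPoly H q else splitRel H u v q := by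
      have h1 : ∏ e : G.edgeSet, (if e.1 ∈ B then relPoly H q else splitRel H u v q) =
          ∏ s ∈ edgeFin G, if s ∈ B then relPoly H q else splitRel H u v q :=
        (Finset.prod_subtype (edgeFin G) (fun _ => mem_edgeFin)
          (fun s => if s ∈ B then relPoly H q else splitRel H u v q)).symm
      rw [h1, Finset.prod_ite, Finset.prod_const, Finset.prod_const, Finset.filter_mem_eq_inter,
        Finset.inter_eq_right.2 hB, Finset.filter_notMem_eq_sdiff, Finset.card_sdiff_of_subset hB]
    have hfactor : ∀ e : G.edgeSet,
        (if e.1 ∈ B then relPoly H q else splitRel H u v q) =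
        ∑ A ∈ (edgeFin H).powerset, if (e.1 ∈ B ↔ J A) ∧ P A then w A else 0 := by
      intro e
      by_cases he : e.1 ∈ B
      · simp only [he, if_true, true_iff, hrel]
      · simp only [he, if_false, false_iff, hsplit]
    rw [hprod, Finset.prod_congr rfl fun e _ => hfactor e, Finset.prod_univ_sum]
    refine Finset.sum_congr rfl fun f _ => ?_
    have hiff : (∀ e : G.edgeSet, (e.1 ∈ B ↔ J (f e)) ∧ P (f e)) ↔
        B = joined f ∧ ∀ e, P (f e) := by
      rw [forall_and]
      refine and_congr_left fun _ => ⟨fun h => ?_, ?_⟩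
      · ext s
        constructor
        · intro hs
          exact (hjoined f ⟨s, mem_edgeFin.1 (hB hs)⟩).2 ((h ⟨s, _⟩).1 hs)
        · intro hs
          have hsG := mem_edgeFin.1 (Finset.mem_filter.1 hs).1
          exact (h ⟨s, hsG⟩).2 ((hjoined f ⟨s, hsG⟩).1 hs)
      · rintro rfl e
        exact hjoined f e
    by_cases h : ∀ e : G.edgeSet, (e.1 ∈ B ↔ J (f e)) ∧ P (f e)
    · rw [if_pos (hiff.1 h)]
      exact Finset.prod_congr rfl fun e _ => if_pos (h e)
    · rw [if_neg (mt hiff.2 h)]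
      obtain ⟨e, he⟩ := not_forall.1 h
      exact Finset.prod_eq_zero (Finset.mem_univ e) (if_neg he)
  have hrhs : ∀ B ∈ (edgeFin G).powerset,
      (if (fromEdgeSet (B : Set (Sym2 V))).Connected then
        relPoly H q ^ B.card * splitRel H u v q ^ ((edgeFin G).card - B.card) else 0) =
      ∑ f ∈ Fintype.piFinset (fun _ : G.edgeSet => (edgeFin H).powerset),
        if B = joined f then
          if (∀ e, P (f e)) ∧ (fromEdgeSet (joined f : Set (Sym2 V))).Connected then
            ∏ e, w (f e) else 0
        else 0 := by
    intro B hB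
    rw [hterm B hB]
    split_ifs with hc
    · refine Finset.sum_congr rfl fun f _ => ?_
      by_cases hBf : B = joined f
      · subst hBf
        simp [hc]
      · simp [hBf]
    · symm
      apply Finset.sum_eq_zero
      intro f _
      by_cases hBf : B = joined f
      · subst hBf
        simp [hc]
      · simp [hBf]
  rw [hlhs, Finset.sum_congr rfl hrhs, Finset.sum_comm]
  refine Finset.sum_congr rfl fun f _ => ?_
  rw [Finset.sum_ite_eq', if_pos (Finset.mem_powerset.2 (Finset.filter_subset _ _))]

end Substitution

/-- If `r ≠ 1` is a reliability root of `G`, then every solution `q` of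
`S(H; q) = (r/(1-r)) Rel(H; q)` is a reliability root of `H` or of `G[H]`. -/
theorem root_of_subGraph {V W : Type} [Finite V] [Finite W]
    (G : SimpleGraph V) (hG : G.Connected)
    (r : ℝ) (hr : r ≠ 1) (hroot : relPoly G r = 0)
    (H : SimpleGraph W) (hH : H.Connected) (u v : W) (huv : u ≠ v) (hadj : ¬ H.Adj u v)
    (q : ℝ) (hq : splitRel H u v q = (r / (1 - r)) * relPoly H q) :
    relPoly H q = 0 ∨ relPoly (subGraph G H u v) q = 0 := by
  classical
  right
  have hr' : 1 - r ≠ 0 := sub_ne_zero.2 hr.symm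
  have hscale : relPoly (subGraph G H u v) q =
      (relPoly H q / (1 - r)) ^ (edgeFin G).card * relPoly G r := by
    rw [relPoly_subGraph G H huv hadj, hq, relPoly.eq_def G r, Finset.mul_sum]
    refine Finset.sum_congr rfl fun B hB => ?_
    rw [mul_ite, mul_zero]
    refine if_congr Iff.rfl ?_ rfl
    obtain ⟨k, hk⟩ := Nat.exists_eq_add_of_le (Finset.card_le_card (Finset.mem_powerset.1 hB))
    rw [hk, Nat.add_sub_cancel_left]
    rw [pow_add, div_mul_eq_mul_div, div_pow, div_pow, div_pow, mul_pow]
    field_simp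
  rw [hscale, hroot, mul_zero]

end
end

section
/- Let K ⊂ (-1,0) be a compact set. Then C_n converges to the constant function 1 uniformly on K; that is, sup_{q ∈ K} |C_n(q) - 1| → 0 as n → ∞. -/
open SimpleGraph Finset

noncomputable section

/-- `Hgraph n` is the complete graph on `Fin n` with the edge between `0` and `1` removed
(for `n ≥ 2`; for `n < 2` no edge is removed). -/
def Hgraph (n : ℕ) : SimpleGraph (Fin n) :=
  (⊤ : SimpleGraph (Fin n)).deleteEdges
    {e | ∃ _h : 2 ≤ n, e = s(⟨0, by omega⟩, ⟨1, by omega⟩)}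

/-- `Cfun n q = Rel(K_n; q)`. -/
def Cfun (n : ℕ) (q : ℝ) : ℝ := relPoly (⊤ : SimpleGraph (Fin n)) q

/-- `Rfun n q = Rel(H_n; q)` where `H_n = K_n` minus an edge. -/
def Rfun (n : ℕ) (q : ℝ) : ℝ := relPoly (Hgraph n) q

/-- `Sfun n q = S(H_n; q)`, the split reliability of `K_n` minus the edge `uv`,
with terminals `u`, `v` the endpoints of the deleted edge. -/
def Sfun (n : ℕ) (q : ℝ) : ℝ :=
  if h : 2 ≤ n then splitRel (Hgraph n) ⟨0, by omega⟩ ⟨1, by omega⟩ q else 0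

/-- `yfun n q = ŷ_{H_n}(q)`. -/
def yfun (n : ℕ) (q : ℝ) : ℝ := Rfun n q / Sfun n q + 1

/-- The edges of the complete graph on the vertex set `S`. -/
def completeEdges {V : Type*} [DecidableEq V] (S : Finset V) : Finset (Sym2 V) :=
  S.offDiag.image Sym2.mk.uncurry

lemma reachable_induction {V : Type*} {G : SimpleGraph V} {u v : V} (h : G.Reachable u v) {P : V → Prop}
    (hu : P u) (hP : ∀ x y, G.Adj x y → P x → P y) : P v := by
  obtain ⟨p⟩ := h
  induction p with
  | nil => exact hu
  | cons hadj _ ih => exact ih (hP _ _ hadj hu)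

section Combinatorics

variable {V : Type*} [DecidableEq V]

lemma mk_mem_completeEdges {S : Finset V} {a b : V} :
    s(a, b) ∈ completeEdges S ↔ a ∈ S ∧ b ∈ S ∧ a ≠ b := by
  simp only [completeEdges, mem_image, mem_offDiag, Prod.exists, Function.uncurry_apply_pair]
  constructor
  · rintro ⟨x, y, ⟨hx, hy, hxy⟩, h⟩
    rcases Sym2.eq_iff.1 h with ⟨rfl, rfl⟩ | ⟨rfl, rfl⟩
    · exact ⟨hx, hy, hxy⟩
    · exact ⟨hy, hx, hxy.symm⟩
  · rintro ⟨ha, hb, hab⟩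
    exact ⟨a, b, ⟨ha, hb, hab⟩, rfl⟩

lemma card_completeEdges (S : Finset V) : #(completeEdges S) = (#S).choose 2 :=
  Sym2.card_image_offDiag S

lemma disjoint_completeEdges {S T : Finset V} (h : Disjoint S T) :
    Disjoint (completeEdges S) (completeEdges T) := by
  rw [Finset.disjoint_left] at h ⊢
  intro e
  induction e with | _ a b =>
  rw [mk_mem_completeEdges, mk_mem_completeEdges]
  exact fun hS hT ↦ h hS.1 hT.1

lemma completeEdges_mono {S T : Finset V} (h : S ⊆ T) : completeEdges S ⊆ completeEdges T :=
  image_subset_image (offDiag_mono h)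

/-- The vertex set of the connected component of `v` in the graph with edge set `A`. -/
def component [Fintype V] (v : V) (A : Finset (Sym2 V)) : Finset V := by
  classical
  exact {u | (fromEdgeSet (A : Set (Sym2 V))).Reachable v u}

lemma mem_component [Fintype V] {u v : V} {A : Finset (Sym2 V)} :
    u ∈ component v A ↔ (fromEdgeSet (A : Set (Sym2 V))).Reachable v u := by
  simp [component]

lemma self_mem_component [Fintype V] (v : V) (A : Finset (Sym2 V)) : v ∈ component v A :=
  mem_component.2 (.refl v)

lemma mem_component_of_mk_mem [Fintype V] {v a b : V} {A : Finset (Sym2 V)}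
    (h : s(a, b) ∈ A) (hab : a ≠ b) (ha : a ∈ component v A) : b ∈ component v A := by
  rw [mem_component] at ha ⊢
  exact ha.trans (SimpleGraph.Adj.reachable ((fromEdgeSet_adj _).2 ⟨mod_cast h, hab⟩))

lemma component_mono [Fintype V] (v : V) {A B : Finset (Sym2 V)} (h : A ⊆ B) :
    component v A ⊆ component v B := by
  intro u hu
  rw [mem_component] at hu ⊢
  exact hu.mono (fromEdgeSet_mono (mod_cast h))

lemma component_subset [Fintype V] {v : V} {A : Finset (Sym2 V)} {P : Finset V} (hv : v ∈ P)
    (hP : ∀ x y, s(x, y) ∈ A → x ≠ y → x ∈ P → y ∈ P) : component v A ⊆ P := by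
  intro u hu
  refine reachable_induction (mem_component.1 hu) hv fun x y hxy ↦ ?_
  rw [fromEdgeSet_adj] at hxy
  exact hP x y (mod_cast hxy.1) hxy.2

lemma subset_union_of_component_eq [Fintype V] {v : V} {A : Finset (Sym2 V)} {S : Finset V}
    (hA : A ⊆ completeEdges univ) (h : component v A = S) :
    A ⊆ completeEdges S ∪ completeEdges Sᶜ := by
  intro e
  induction e with | _ a b =>
  intro he
  have hab := (mk_mem_completeEdges.1 (hA he)).2.2
  have h1 := mem_component_of_mk_mem (v := v) he hab
  have h2 := mem_component_of_mk_mem (v := v) (Sym2.eq_swap ▸ he) hab.symm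
  rw [h] at h1 h2
  simp only [mem_union, mk_mem_completeEdges, mem_compl]
  tauto

lemma component_inter_completeEdges [Fintype V] {v : V} {A : Finset (Sym2 V)} {S : Finset V}
    (h : component v A = S) : component v (A ∩ completeEdges S) = S := by
  apply subset_antisymm
  · exact (component_mono v inter_subset_left).trans h.subset
  · nth_rw 1 [← h]
    refine component_subset (self_mem_component _ _) fun x y hA hxy hx ↦ ?_
    have hxS := h ▸ component_mono v inter_subset_left hx
    have hyS := h ▸ mem_component_of_mk_mem hA hxy (component_mono v inter_subset_left hx)
    exact mem_component_of_mk_mem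
      (mem_inter.2 ⟨hA, mk_mem_completeEdges.2 ⟨hxS, hyS, hxy⟩⟩) hxy hx

lemma component_union [Fintype V] {v : V} {A B : Finset (Sym2 V)} {S : Finset V}
    (hA : A ⊆ completeEdges S) (hB : B ⊆ completeEdges Sᶜ) (h : component v A = S) :
    component v (A ∪ B) = S := by
  apply subset_antisymm
  · refine component_subset (h ▸ self_mem_component v A) fun x y hxy _ hx ↦ ?_
    rcases mem_union.1 hxy with he | he
    · exact (mk_mem_completeEdges.1 (hA he)).2.1
    · exact absurd hx (mem_compl.1 (mk_mem_completeEdges.1 (hB he)).1)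
  · exact h ▸ component_mono v subset_union_left

/-- The probability that the component of `v` in the complete graph on `S` is all of `S`, when
every edge fails independently with probability `q`. -/
def connProb [Fintype V] (v : V) (S : Finset V) (q : ℝ) : ℝ :=
  ∑ A ∈ (completeEdges S).powerset with component v A = S,
    (1 - q) ^ #A * q ^ (#(completeEdges S) - #A)

lemma card_completeEdges_univ [Fintype V] (S : Finset V) :
    #(completeEdges (univ : Finset V)) =
      #(completeEdges S) + #(completeEdges Sᶜ) + #S * #Sᶜ := by
  rw [card_completeEdges, card_completeEdges, card_completeEdges, card_univ,
    ← card_add_card_compl S]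
  generalize #S = a
  generalize #Sᶜ = b
  induction a with
  | zero => simp
  | succ a ih => rw [Nat.succ_add, Nat.choose_succ_succ', Nat.choose_succ_succ' a, ih]; simp; ring

lemma sum_component_eq [Fintype V] (v : V) (S : Finset V) (q : ℝ) :
    ∑ A ∈ (completeEdges univ).powerset with component v A = S,
      (1 - q) ^ #A * q ^ (#(completeEdges (univ : Finset V)) - #A) =
    connProb v S q * q ^ (#S * #Sᶜ) := by
  have hdisj : Disjoint (completeEdges S) (completeEdges Sᶜ) :=
    disjoint_completeEdges disjoint_compl_right
  have hprod : connProb v S q = connProb v S q * ∑ B ∈ (completeEdges Sᶜ).powerset,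
      (1 - q) ^ #B * q ^ (#(completeEdges Sᶜ) - #B) := by
    rw [sum_pow_mul_eq_add_pow]; simp
  rw [hprod, connProb, sum_mul_sum, ← sum_product', sum_mul]
  refine sum_nbij' (fun A ↦ (A ∩ completeEdges S, A ∩ completeEdges Sᶜ)) (fun p ↦ p.1 ∪ p.2)
    ?_ ?_ ?_ ?_ ?_
  · intro A hA
    simp only [mem_filter, mem_product, mem_powerset] at hA ⊢
    exact ⟨⟨inter_subset_right, component_inter_completeEdges hA.2⟩, inter_subset_right⟩
  · rintro ⟨A, B⟩ h
    simp only [mem_filter, mem_product, mem_powerset] at h ⊢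
    exact ⟨union_subset (h.1.1.trans (completeEdges_mono (subset_univ _)))
      (h.2.trans (completeEdges_mono (subset_univ _))), component_union h.1.1 h.2 h.1.2⟩
  · intro A hA
    simp only [mem_filter, mem_powerset] at hA
    rw [← inter_union_distrib_left]
    exact inter_eq_left.2 (subset_union_of_component_eq hA.1 hA.2)
  · rintro ⟨A, B⟩ h
    simp only [mem_filter, mem_product, mem_powerset] at h
    rw [union_inter_distrib_right, union_inter_distrib_right, inter_eq_left.2 h.1.1,
      inter_eq_left.2 h.2, disjoint_iff_inter_eq_empty.1 (hdisj.symm.mono_left h.2),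
      disjoint_iff_inter_eq_empty.1 (hdisj.mono_left h.1.1), union_empty, empty_union]
  · intro A hA
    simp only [mem_filter, mem_powerset] at hA
    have hcard : #A = #(A ∩ completeEdges S) + #(A ∩ completeEdges Sᶜ) := by
      rw [← card_union_of_disjoint (hdisj.mono inter_subset_right inter_subset_right),
        ← inter_union_distrib_left,
        inter_eq_left.2 (subset_union_of_component_eq hA.1 hA.2)]
    have h1 : #(A ∩ completeEdges S) ≤ #(completeEdges S) := card_le_card inter_subset_right
    have h2 : #(A ∩ completeEdges Sᶜ) ≤ #(completeEdges Sᶜ) := card_le_card inter_subset_right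
    have hexp : #(completeEdges (univ : Finset V)) - #A =
        (#(completeEdges S) - #(A ∩ completeEdges S)) +
          (#(completeEdges Sᶜ) - #(A ∩ completeEdges Sᶜ)) + #S * #Sᶜ := by
      rw [card_completeEdges_univ S]
      omega
    rw [hexp, hcard]
    ring

lemma sum_connProb_mul_pow [Fintype V] (v : V) (q : ℝ) :
    ∑ S ∈ (univ : Finset V).powerset, connProb v S q * q ^ (#S * #Sᶜ) = 1 := by
  simp_rw [← sum_component_eq]
  rw [sum_fiberwise_of_maps_to (by simp), sum_pow_mul_eq_add_pow]
  simp

lemma connProb_of_notMem [Fintype V] {v : V} {S : Finset V} (h : v ∉ S) (q : ℝ) :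
    connProb v S q = 0 := by
  rw [connProb, filter_false_of_mem, sum_empty]
  rintro A - rfl
  exact h (self_mem_component v A)

lemma map_completeEdges {W : Type*} [DecidableEq W] (f : V ↪ W) (S : Finset V) :
    (completeEdges S).map f.sym2Map = completeEdges (S.map f) := by
  ext e
  induction e with | _ a b =>
  simp only [mem_map, mk_mem_completeEdges]
  constructor
  · rintro ⟨e, he, h⟩
    induction e with | _ x y =>
    rw [mk_mem_completeEdges] at he
    rcases Sym2.eq_iff.1 h with ⟨rfl, rfl⟩ | ⟨rfl, rfl⟩
    · exact ⟨⟨x, he.1, rfl⟩, ⟨y, he.2.1, rfl⟩, f.injective.ne he.2.2⟩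
    · exact ⟨⟨y, he.2.1, rfl⟩, ⟨x, he.1, rfl⟩, f.injective.ne he.2.2.symm⟩
  · rintro ⟨⟨x, hx, rfl⟩, ⟨y, hy, rfl⟩, hxy⟩
    exact ⟨s(x, y), mk_mem_completeEdges.2 ⟨hx, hy, fun h ↦ hxy (h ▸ rfl)⟩, rfl⟩

lemma component_map [Fintype V] {W : Type*} [DecidableEq W] [Fintype W] (f : V ↪ W) (v : V)
    (A : Finset (Sym2 V)) : component (f v) (A.map f.sym2Map) = (component v A).map f := by
  apply subset_antisymm
  · refine component_subset (mem_map_of_mem _ (self_mem_component v A)) fun x y hmem hxy hx ↦ ?_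
    obtain ⟨a, ha, rfl⟩ := mem_map.1 hx
    obtain ⟨e, he, h⟩ := mem_map.1 hmem
    induction e with | _ c d =>
    rcases Sym2.eq_iff.1 h with ⟨h1, rfl⟩ | ⟨rfl, h1⟩
    · obtain rfl := f.injective h1
      exact mem_map_of_mem _ (mem_component_of_mk_mem he (fun h ↦ hxy (h ▸ rfl)) ha)
    · obtain rfl := f.injective h1
      exact mem_map_of_mem _
        (mem_component_of_mk_mem (Sym2.eq_swap ▸ he) (fun h ↦ hxy (h ▸ rfl)) ha)
  · intro w hw
    obtain ⟨u, hu, rfl⟩ := mem_map.1 hw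
    refine reachable_induction (P := fun u ↦ f u ∈ component (f v) (A.map f.sym2Map))
      (mem_component.1 hu) (self_mem_component _ _) fun x y hxy hx ↦ ?_
    rw [fromEdgeSet_adj] at hxy
    exact mem_component_of_mk_mem (mem_map.2 ⟨s(x, y), mod_cast hxy.1, rfl⟩)
      (f.injective.ne hxy.2) hx

lemma connProb_map [Fintype V] {W : Type*} [DecidableEq W] [Fintype W] (f : V ↪ W) (v : V)
    (S : Finset V) (q : ℝ) : connProb (f v) (S.map f) q = connProb v S q := by
  rw [connProb, connProb, ← map_completeEdges]
  symm
  refine sum_bij (fun A _ ↦ A.map f.sym2Map) ?_ ?_ ?_ ?_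
  · intro A hA
    simp only [mem_filter, mem_powerset] at hA ⊢
    exact ⟨map_subset_map.2 hA.1, by rw [component_map, hA.2]⟩
  · intro A _ B _ h
    exact map_injective _ h
  · intro B hB
    simp only [mem_filter, mem_powerset] at hB
    obtain ⟨A, hA, rfl⟩ := subset_map_iff.1 hB.1
    rw [component_map] at hB
    exact ⟨A, mem_filter.2 ⟨mem_powerset.2 hA, map_injective f hB.2⟩, rfl⟩
  · intro A _
    simp

end Combinatorics

lemma edgeFin_top (n : ℕ) : edgeFin (⊤ : SimpleGraph (Fin n)) = completeEdges univ := by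
  ext e
  induction e with | _ a b =>
  simp [edgeFin, mk_mem_completeEdges]

lemma cfun_eq_connProb_univ {n : ℕ} (v : Fin n) (q : ℝ) : Cfun n q = connProb v univ q := by
  rw [Cfun, relPoly, edgeFin_top, connProb, sum_filter]
  refine sum_congr rfl fun A _ ↦ ?_
  congr 1
  rw [eq_iff_iff, eq_univ_iff_forall]
  simp only [mem_component]
  constructor
  · exact fun h u ↦ h.preconnected v u
  · exact fun h ↦ { preconnected := fun a b ↦ (h a).symm.trans (h b), nonempty := ⟨v⟩ }

lemma connProb_eq_cfun {V : Type*} [DecidableEq V] [Fintype V] {v : V} {S : Finset V}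
    (hv : v ∈ S) (q : ℝ) : connProb v S q = Cfun #S q := by
  let f : Fin #S ↪ V := S.equivFin.symm.toEmbedding.trans (Function.Embedding.subtype _)
  have hf : univ.map f = S := by
    ext x
    simp only [f, mem_map, mem_univ, true_and]
    constructor
    · rintro ⟨i, rfl⟩
      exact (S.equivFin.symm i).2
    · exact fun hx ↦ ⟨S.equivFin ⟨x, hx⟩, by simp⟩
  obtain ⟨i, -, rfl⟩ := mem_map.1 (hf ▸ hv)
  rw [cfun_eq_connProb_univ i, ← connProb_map f, hf]

lemma abs_cfun_sub_one_le (n : ℕ) (hn : 1 ≤ n) (q : ℝ) :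
    |Cfun n q - 1| ≤
      ∑ k ∈ Ico 1 n, (n.choose k : ℝ) * (|Cfun k q| * |q| ^ (k * (n - k))) := by
  let v : Fin n := ⟨0, hn⟩
  have hsum := sum_connProb_mul_pow v q
  rw [← add_sum_erase _ _ (mem_powerset_self univ), ← cfun_eq_connProb_univ v q] at hsum
  simp only [compl_univ, card_empty, mul_zero, pow_zero, mul_one] at hsum
  let g : ℕ → ℝ := fun k ↦ if k ∈ Ico 1 n then |Cfun k q| * |q| ^ (k * (n - k)) else 0
  have hg : ∀ k, 0 ≤ g k := fun k ↦ by dsimp only [g]; split_ifs <;> positivity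
  calc |Cfun n q - 1|
      = |∑ S ∈ (univ : Finset (Fin n)).powerset.erase univ,
          connProb v S q * q ^ (#S * #Sᶜ)| := by
        rw [← hsum, ← abs_neg]; congr 1; ring
    _ ≤ ∑ S ∈ (univ : Finset (Fin n)).powerset.erase univ,
          |connProb v S q * q ^ (#S * #Sᶜ)| := abs_sum_le_sum_abs _ _
    _ ≤ ∑ S ∈ (univ : Finset (Fin n)).powerset.erase univ, g #S := by
        refine sum_le_sum fun S hS ↦ ?_
        by_cases hv : v ∈ S
        · have hlt : #S < n := by
            simpa using card_lt_card (ssubset_univ_iff.2 (ne_of_mem_erase hS))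
          have hpos : 1 ≤ #S := card_pos.2 ⟨v, hv⟩
          simp only [g, mem_Ico, hpos, hlt, and_self, if_true]
          rw [connProb_eq_cfun hv, abs_mul, abs_pow, card_compl, Fintype.card_fin]
        · rw [connProb_of_notMem hv]
          simpa using hg _
    _ ≤ ∑ S ∈ (univ : Finset (Fin n)).powerset, g #S :=
        sum_le_sum_of_subset_of_nonneg (erase_subset _ _) fun _ _ _ ↦ hg _
    _ = ∑ k ∈ range (n + 1), (n.choose k : ℝ) * g k := by
        rw [sum_powerset_apply_card g]; simp
    _ = ∑ k ∈ Ico 1 n, (n.choose k : ℝ) * (|Cfun k q| * |q| ^ (k * (n - k))) := by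
        simp only [g, mul_ite, mul_zero]
        rw [← sum_filter]
        refine sum_congr ?_ fun _ _ ↦ rfl
        ext k
        simp only [mem_filter, mem_range, mem_Ico]
        omega

lemma choose_mul_pow_le {s : ℝ} (hs0 : 0 ≤ s) (hs1 : s ≤ 1) {n k : ℕ} (hk : k ∈ Ico 1 n)
    (hx : n * s ^ n ≤ 1) : (n.choose k : ℝ) * (s ^ 2) ^ (k * (n - k)) ≤ n * s ^ n := by
  obtain ⟨hk1, hkn⟩ := mem_Ico.1 hk
  wlog hle : 2 * k ≤ n generalizing k
  · have := this (k := n - k) (mem_Ico.2 ⟨by omega, by omega⟩) (by omega) (by omega) (by omega)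
    rwa [Nat.choose_symm hkn.le, Nat.sub_sub_self hkn.le, mul_comm (n - k)] at this
  have hexp : n * k ≤ 2 * (k * (n - k)) := by
    have : n ≤ 2 * (n - k) := by omega
    nlinarith
  calc (n.choose k : ℝ) * (s ^ 2) ^ (k * (n - k))
      ≤ (n : ℝ) ^ k * s ^ (n * k) := by
        rw [← pow_mul]
        exact mul_le_mul (mod_cast Nat.choose_le_pow n k) (pow_le_pow_of_le_one hs0 hs1 hexp)
          (by positivity) (by positivity)
    _ = (n * s ^ n) ^ k := by rw [mul_pow, ← pow_mul]
    _ ≤ n * s ^ n := pow_le_of_le_one (by positivity) hx (by omega)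

lemma abs_cfun_sub_one_le_mul {s : ℝ} (hs0 : 0 ≤ s) (hs1 : s ≤ 1) {n : ℕ} (hn : 1 ≤ n)
    (hx : n * s ^ n ≤ 1) {q M : ℝ} (hq : |q| ≤ s ^ 2) (hM : ∀ k < n, |Cfun k q| ≤ M) :
    |Cfun n q - 1| ≤ M * (n ^ 2 * s ^ n) := by
  have hM0 : 0 ≤ M := (abs_nonneg _).trans (hM 0 hn)
  calc |Cfun n q - 1|
      ≤ ∑ k ∈ Ico 1 n, (n.choose k : ℝ) * (|Cfun k q| * |q| ^ (k * (n - k))) :=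
        abs_cfun_sub_one_le n hn q
    _ ≤ ∑ k ∈ Ico 1 n, M * (n * s ^ n) := by
        refine sum_le_sum fun k hk ↦ ?_
        calc (n.choose k : ℝ) * (|Cfun k q| * |q| ^ (k * (n - k)))
            ≤ (n.choose k : ℝ) * (M * (s ^ 2) ^ (k * (n - k))) := by
              gcongr
              exact hM k (mem_Ico.1 hk).2
          _ = M * ((n.choose k : ℝ) * (s ^ 2) ^ (k * (n - k))) := by ring
          _ ≤ M * (n * s ^ n) :=
              mul_le_mul_of_nonneg_left (choose_mul_pow_le hs0 hs1 hk hx) hM0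
    _ = (n - 1 : ℕ) * (M * (n * s ^ n)) := by simp
    _ ≤ n * (M * (n * s ^ n)) := by
        gcongr
        exact Nat.sub_le n 1
    _ = M * (n ^ 2 * s ^ n) := by ring

lemma exists_abs_cfun_le (n : ℕ) : ∃ a : ℝ, ∀ q : ℝ, |q| ≤ 1 → |Cfun n q| ≤ a := by
  classical
  refine ⟨∑ A ∈ (edgeFin (⊤ : SimpleGraph (Fin n))).powerset, 2 ^ #A, fun q hq ↦ ?_⟩
  rw [Cfun, relPoly]
  refine (abs_sum_le_sum_abs _ _).trans (sum_le_sum fun A _ ↦ ?_)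
  split_ifs
  · rw [abs_mul, abs_pow, abs_pow]
    have h2 : |1 - q| ≤ 2 := by rw [abs_le] at hq ⊢; constructor <;> linarith
    calc |1 - q| ^ #A * |q| ^ _ ≤ 2 ^ #A * 1 :=
          mul_le_mul (pow_le_pow_left₀ (abs_nonneg _) h2 _) (pow_le_one₀ (abs_nonneg _) hq)
            (by positivity) (by positivity)
      _ = 2 ^ #A := mul_one _
  · simp

lemma tendsto_sq_mul_pow {s : ℝ} (hs0 : 0 ≤ s) (hs1 : s < 1) :
    Filter.Tendsto (fun n : ℕ ↦ (n : ℝ) ^ 2 * s ^ n) Filter.atTop (nhds 0) :=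
  tendsto_pow_const_mul_const_pow_of_abs_lt_one 2 (by rwa [abs_of_nonneg hs0])

lemma natCast_mul_pow_le_sq_mul_pow {s : ℝ} (hs0 : 0 ≤ s) (n : ℕ) :
    (n : ℝ) * s ^ n ≤ (n : ℝ) ^ 2 * s ^ n := by
  gcongr
  exact_mod_cast Nat.le_self_pow two_ne_zero n

lemma exists_forall_abs_cfun_le {s : ℝ} (hs0 : 0 ≤ s) (hs1 : s < 1) :
    ∃ M : ℝ, ∀ n : ℕ, ∀ q : ℝ, |q| ≤ s ^ 2 → |Cfun n q| ≤ M := by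
  choose a ha using exists_abs_cfun_le
  obtain ⟨N, hN⟩ := Filter.eventually_atTop.1
    ((tendsto_sq_mul_pow hs0 hs1).eventually_le_const (show (0 : ℝ) < 1 / 2 by norm_num))
  refine ⟨2 + ∑ k ∈ range (N + 1), |a k|, fun n q hq ↦ ?_⟩
  have hpos : 0 ≤ ∑ k ∈ range (N + 1), |a k| := sum_nonneg fun _ _ ↦ abs_nonneg _
  induction n using Nat.strong_induction_on with
  | _ n ih =>
  rcases le_or_gt n N with hle | hlt
  · have h1 := ha n q (hq.trans (pow_le_one₀ hs0 hs1.le))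
    have h2 : |a n| ≤ ∑ k ∈ range (N + 1), |a k| :=
      single_le_sum (fun k _ ↦ abs_nonneg (a k)) (mem_range.2 (by omega))
    linarith [le_abs_self (a n)]
  · have hsq := hN n hlt.le
    have h1 := abs_cfun_sub_one_le_mul hs0 hs1.le (by omega)
      ((natCast_mul_pow_le_sq_mul_pow hs0 n).trans (hsq.trans (by norm_num))) hq ih
    have h2 : |Cfun n q| ≤ |Cfun n q - 1| + 1 := by
      simpa using abs_add_le (Cfun n q - 1) 1
    nlinarith

open Filter in
/-- `C_n → 1` uniformly on any compact `K ⊂ (-1, 0)`. -/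
theorem cfun_tendsto_one (K : Set ℝ) (hKc : IsCompact K) (hK : K ⊆ Set.Ioo (-1 : ℝ) 0) :
    Tendsto (fun n : ℕ => ⨆ q ∈ K, |Cfun n q - 1|) atTop (nhds 0) := by
  obtain ⟨s, hs0, hs1, hs⟩ : ∃ s : ℝ, 0 ≤ s ∧ s < 1 ∧ ∀ q ∈ K, |q| ≤ s ^ 2 := by
    rcases K.eq_empty_or_nonempty with rfl | hne
    · exact ⟨0, le_rfl, one_pos, by simp⟩
    · obtain ⟨r, hr, hmax⟩ := hKc.exists_isMaxOn hne continuous_abs.continuousOn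
      refine ⟨√|r|, Real.sqrt_nonneg _, ?_, fun q hq ↦ ?_⟩
      · rw [Real.sqrt_lt' one_pos, one_pow, abs_lt]
        exact ⟨(hK hr).1, (hK hr).2.trans one_pos⟩
      · rw [Real.sq_sqrt (abs_nonneg r)]
        exact hmax hq
  obtain ⟨M, hM⟩ := exists_forall_abs_cfun_le hs0 hs1
  have hM0 : 0 ≤ M := (abs_nonneg _).trans (hM 0 0 (by simpa using sq_nonneg s))
  have hlim := tendsto_sq_mul_pow hs0 hs1
  refine squeeze_zero' (.of_forall fun n ↦ Real.iSup_nonneg fun q ↦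
    Real.iSup_nonneg fun _ ↦ abs_nonneg _) ?_ (by simpa using hlim.const_mul M)
  filter_upwards [hlim.eventually_le_const one_pos, eventually_ge_atTop 1] with n hn1 hn
  have hbound : 0 ≤ M * ((n : ℝ) ^ 2 * s ^ n) := by positivity
  exact Real.iSup_le (fun q ↦ Real.iSup_le (fun hq ↦ abs_cfun_sub_one_le_mul hs0 hs1.le hn
    ((natCast_mul_pow_le_sq_mul_pow hs0 n).trans hn1) (hs q hq)
    fun k _ ↦ hM k q (hs q hq)) hbound) hbound

end
end
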